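/- Chernoff's theorem (non-equidistant version): Let (S_t)_{t≥0} be a proper family of bounded linear operators on a Banach space X with L = DS. Let T_n = (t_1^n,…,t_{r_n}^n) be partitions (tuples of positive reals) with total length L(T_n) = t_1^n + … + t_{r_n}^n → τ > 0 and mesh |T_n| = max_j t_j^n → 0 as n → ∞. Then for every u ∈ X, S_{t_1^n} ∘ ⋯ ∘ S_{t_{r_n}^n} u → e^{τL} u. -/

import Mathlib

open Filter Topology

/-- The data of a closed, densely defined operator `L` (given as a total function, meaningful
on its domain `dom`) generating a strongly continuous semigroup `E t = e^{tL}` on `X`. -/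
structure Generator (X : Type*) [NormedAddCommGroup X] [NormedSpace ℝ X] where
  dom : Set X
  L : X → X
  E : ℝ → X →L[ℝ] X
  dense_dom : Dense dom
  closed_graph : IsClosed {p : X × X | p.1 ∈ dom ∧ L p.1 = p.2}
  E_zero : E 0 = ContinuousLinearMap.id ℝ X
  E_add : ∀ s t : ℝ, 0 ≤ s → 0 ≤ t → E (s + t) = (E s).comp (E t)
  E_cont : ∀ u : X, ContinuousOn (fun t => E t u) (Set.Ici 0)
  E_maps_dom : ∀ a : ℝ, 0 ≤ a → ∀ v ∈ dom, E a v ∈ dom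
  E_deriv : ∀ v ∈ dom,
    Tendsto (fun t : ℝ => t⁻¹ • (E t v - v)) (𝓝[>] 0) (𝓝 (L v))

/-- `S` is a proper family with generator `G` (i.e. `DS = G.L`): `S 0 = id`, `S` is strongly
continuous, `‖S t‖ = 1 + O(t)` as `t ↘ 0`, and `(S_t - id)u/t → Lu` for all
`u = e^{aL}v`, `a > 0`, `v ∈ dom L`. -/
def IsProperFamily {X : Type*} [NormedAddCommGroup X] [NormedSpace ℝ X]
    (S : ℝ → X →L[ℝ] X) (G : Generator X) : Prop :=
  S 0 = ContinuousLinearMap.id ℝ X ∧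
  (∀ u : X, ContinuousOn (fun t => S t u) (Set.Ici 0)) ∧
  (∃ C ε : ℝ, 0 < C ∧ 0 < ε ∧ ∀ t ∈ Set.Ioc (0:ℝ) ε, ‖S t‖ ≤ 1 + C * t) ∧
  (∀ a : ℝ, 0 < a → ∀ v ∈ G.dom,
    Tendsto (fun t : ℝ => t⁻¹ • (S t (G.E a v) - G.E a v)) (𝓝[>] 0)
      (𝓝 (G.L (G.E a v))))

section Lists

/-- A list of positive numbers bounded by `δ` has a suffix whose sum is within `δ` of any
prescribed nonnegative number not exceeding the total sum by more than `δ`. -/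
theorem exists_append_abs_sum_sub_le {δ : ℝ} {l : List ℝ} (hl : ∀ t ∈ l, 0 < t ∧ t ≤ δ)
    {s : ℝ} (hs : 0 ≤ s) (hsl : s ≤ l.sum + δ) :
    ∃ l₁ l₂, l = l₁ ++ l₂ ∧ |l₂.sum - s| ≤ δ := by
  induction l with
  | nil =>
    refine ⟨[], [], rfl, ?_⟩
    simp only [List.sum_nil] at hsl ⊢
    rw [abs_le]
    constructor <;> linarith
  | cons t l ih =>
    by_cases h : s ≤ l.sum + δ
    · obtain ⟨l₁, l₂, rfl, h₂⟩ := ih (fun t ht => hl t (List.mem_cons_of_mem _ ht)) h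
      exact ⟨t :: l₁, l₂, rfl, h₂⟩
    · refine ⟨[], t :: l, rfl, ?_⟩
      have := hl t List.mem_cons_self
      simp only [List.sum_cons] at hsl ⊢
      rw [abs_le]
      constructor <;> linarith

theorem le_foldr_max {l : List ℝ} {t : ℝ} (ht : t ∈ l) : t ≤ l.foldr max 0 := by
  induction l with
  | nil => simp at ht
  | cons a l ih =>
    rcases List.mem_cons.1 ht with rfl | h
    · exact le_max_left _ _
    · exact (ih h).trans (le_max_right _ _)

theorem le_sum_of_forall_pos {l : List ℝ} (hl : ∀ t ∈ l, 0 < t) {t : ℝ} (ht : t ∈ l) :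
    t ≤ l.sum :=
  List.single_le_sum (fun a ha => (hl a ha).le) t ht

theorem sum_nonneg_of_forall_pos {l : List ℝ} (hl : ∀ t ∈ l, 0 < t) : 0 ≤ l.sum :=
  List.sum_nonneg fun a ha => (hl a ha).le

end Lists

section Products

variable {X : Type*} [NormedAddCommGroup X] [NormedSpace ℝ X]

theorem exists_norm_sub_sub_smul_le {f : ℝ → X} {x y : X}
    (hf : Tendsto (fun t : ℝ => t⁻¹ • (f t - x)) (𝓝[>] 0) (𝓝 y)) {η : ℝ} (hη : 0 < η) :
    ∃ δ : ℝ, 0 < δ ∧ ∀ t, 0 < t → t ≤ δ → ‖f t - x - t • y‖ ≤ η * t := by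
  have h := (Metric.tendsto_nhds.1 hf η hη)
  obtain ⟨δ, hδ, hsub⟩ := mem_nhdsGT_iff_exists_Ioc_subset.1 h
  refine ⟨δ, hδ, fun t ht htδ => ?_⟩
  have h1 : dist (t⁻¹ • (f t - x)) y < η := hsub ⟨ht, htδ⟩
  have h2 : f t - x - t • y = t • (t⁻¹ • (f t - x) - y) := by
    rw [smul_sub, smul_inv_smul₀ ht.ne']
  rw [h2, norm_smul, Real.norm_of_nonneg ht.le, mul_comm, ← dist_eq_norm]
  gcongr

theorem norm_apply_sub_le (P : X →L[ℝ] X) (p x x' z : X) (r h : ℝ) :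
    ‖P p - x'‖ ≤ ‖P‖ * ‖p - x‖ + ‖P x - x - r • z‖ + |r - h| * ‖z‖ + ‖x' - x - h • z‖ := by
  have e : P p - x' = P (p - x) + (P x - x - r • z) + (r - h) • z - (x' - x - h • z) := by
    rw [map_sub, sub_smul]
    abel
  rw [e, ← Real.norm_eq_abs, ← norm_smul (r - h) z]
  refine (norm_sub_le _ _).trans ?_
  gcongr
  refine norm_add₃_le.trans ?_
  gcongr
  exact P.le_opNorm _

variable {S : ℝ → X →L[ℝ] X} {C ε : ℝ}

theorem norm_prod_map_le (hS : ∀ t ∈ Set.Ioc (0 : ℝ) ε, ‖S t‖ ≤ 1 + C * t)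
    {l : List ℝ} (hl : ∀ t ∈ l, 0 < t ∧ t ≤ ε) :
    ‖(l.map S).prod‖ ≤ Real.exp (C * l.sum) := by
  induction l with
  | nil =>
    rw [List.map_nil, List.prod_nil, List.sum_nil, mul_zero, Real.exp_zero]
    exact ContinuousLinearMap.norm_id_le
  | cons t l ih =>
    have ih := ih fun t ht => hl t (List.mem_cons_of_mem _ ht)
    have ht := hS t (hl t List.mem_cons_self)
    rw [List.map_cons, List.prod_cons, List.sum_cons, mul_add, Real.exp_add]
    refine (norm_mul_le _ _).trans ?_
    have : ‖S t‖ ≤ Real.exp (C * t) := by linarith [Real.add_one_le_exp (C * t)]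
    gcongr

theorem norm_prod_map_sub_le (hC : 0 ≤ C)
    (hS : ∀ t ∈ Set.Ioc (0 : ℝ) ε, ‖S t‖ ≤ 1 + C * t) {x : X} {c : ℝ} (hc : 0 ≤ c)
    {l : List ℝ} (hl : ∀ t ∈ l, 0 < t ∧ t ≤ ε) (hx : ∀ t ∈ l, ‖S t x - x‖ ≤ c * t) :
    ‖(l.map S).prod x - x‖ ≤ Real.exp (C * l.sum) * (c * l.sum) := by
  induction l with
  | nil => simp
  | cons t l ih =>
    have hl' : ∀ t ∈ l, 0 < t ∧ t ≤ ε := fun t ht => hl t (List.mem_cons_of_mem _ ht)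
    have ih := ih hl' fun t ht => hx t (List.mem_cons_of_mem _ ht)
    have htl := hl t List.mem_cons_self
    have ht := hS t htl
    have hxt := hx t List.mem_cons_self
    have hsum := sum_nonneg_of_forall_pos fun t ht => (hl' t ht).1
    have h1 : ‖S t‖ ≤ Real.exp (C * t) := by linarith [Real.add_one_le_exp (C * t)]
    have h2 : (((t :: l).map S).prod) x - x
        = S t ((l.map S).prod x - x) + (S t x - x) := by
      simp [map_sub]
    have h3 : 1 ≤ Real.exp (C * t) * Real.exp (C * l.sum) := by
      rw [← Real.exp_add]
      exact Real.one_le_exp (add_nonneg (mul_nonneg hC htl.1.le) (mul_nonneg hC hsum))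
    rw [h2, List.sum_cons, mul_add C, Real.exp_add]
    calc _ ≤ ‖S t ((l.map S).prod x - x)‖ + ‖S t x - x‖ := norm_add_le _ _
      _ ≤ Real.exp (C * t) * (Real.exp (C * l.sum) * (c * l.sum)) + 1 * (c * t) := by
          rw [one_mul]
          refine add_le_add (((S t).le_opNorm _).trans ?_) hxt
          gcongr
      _ ≤ Real.exp (C * t) * (Real.exp (C * l.sum) * (c * l.sum))
          + Real.exp (C * t) * Real.exp (C * l.sum) * (c * t) := by
          have := mul_nonneg hc htl.1.le
          gcongr
      _ = _ := by ring

/-- First-order expansion of a product of the `S t` along a list of small total length. -/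
theorem norm_prod_map_sub_sub_smul_le {x y : X} {δ σ K η : ℝ}
    (hx : ∀ t, 0 < t → t ≤ δ → ‖S t x - x - t • y‖ ≤ η * t)
    (hK : ∀ l : List ℝ, (∀ t ∈ l, 0 < t) → l.sum ≤ σ → ‖(l.map S).prod‖ ≤ K)
    (hy : ∀ l : List ℝ, (∀ t ∈ l, 0 < t) → l.sum ≤ σ → ‖(l.map S).prod y - y‖ ≤ η)
    {l : List ℝ} (hl : ∀ t ∈ l, 0 < t ∧ t ≤ δ) (hsum : l.sum ≤ σ) :
    ‖(l.map S).prod x - x - l.sum • y‖ ≤ (K + 1) * η * l.sum := by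
  induction l using List.reverseRecOn with
  | nil => simp
  | append_singleton l t ih =>
    have ht := hl t (by simp)
    have hl' : ∀ t ∈ l, 0 < t ∧ t ≤ δ := fun t ht => hl t (List.mem_append_left _ ht)
    rw [List.sum_append, List.sum_singleton] at hsum ⊢
    have hsum' : l.sum ≤ σ := by linarith [ht.1]
    have hpos : ∀ t ∈ l, 0 < t := fun t ht => (hl' t ht).1
    have ih := ih hl' hsum'
    have h1 := hK l hpos hsum'
    have h2 := hy l hpos hsum'
    have h3 := hx t ht.1 ht.2
    have h4 : (((l ++ [t]).map S).prod) x - x - (l.sum + t) • y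
        = ((l.map S).prod x - x - l.sum • y) + (l.map S).prod (S t x - x - t • y)
          + t • ((l.map S).prod y - y) := by
      simp only [List.map_append, List.map_cons, List.map_nil, List.prod_append,
        List.prod_singleton, mul_apply_eq_comp, map_sub, map_smul, add_smul, smul_sub]
      abel
    rw [h4]
    calc _ ≤ ‖(l.map S).prod x - x - l.sum • y‖ + ‖(l.map S).prod (S t x - x - t • y)‖
          + ‖t • ((l.map S).prod y - y)‖ := norm_add₃_le
      _ ≤ (K + 1) * η * l.sum + K * (η * t) + t * η := by
          rw [norm_smul, Real.norm_of_nonneg ht.1.le]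
          refine add_le_add (add_le_add ih ?_) (mul_le_mul_of_nonneg_left h2 ht.1.le)
          refine ((l.map S).prod.le_opNorm _).trans ?_
          have := (norm_nonneg _).trans h1
          gcongr
      _ = _ := by ring

end Products

namespace Generator

variable {X : Type*} [NormedAddCommGroup X] [NormedSpace ℝ X] (G : Generator X)

theorem E_add_apply {s t : ℝ} (hs : 0 ≤ s) (ht : 0 ≤ t) (x : X) :
    G.E (s + t) x = G.E s (G.E t x) := by
  rw [G.E_add s t hs ht]; rfl

theorem L_E {s : ℝ} (hs : 0 ≤ s) {v : X} (hv : v ∈ G.dom) :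
    G.L (G.E s v) = G.E s (G.L v) := by
  have h1 := G.E_deriv _ (G.E_maps_dom s hs v hv)
  have h2 := ((G.E s).continuous.tendsto (G.L v)).comp (G.E_deriv v hv)
  refine tendsto_nhds_unique (h1.congr' ?_) h2
  filter_upwards [self_mem_nhdsWithin] with t ht
  have ht : (0 : ℝ) ≤ t := le_of_lt ht
  simp only [Function.comp_apply, map_smul, map_sub]
  rw [← G.E_add_apply hs ht, ← G.E_add_apply ht hs, add_comm]

theorem exists_norm_E_le [CompleteSpace X] (τ : ℝ) :
    ∃ M : ℝ, 0 ≤ M ∧ ∀ s ∈ Set.Icc 0 τ, ‖G.E s‖ ≤ M := by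
  obtain ⟨M, hM⟩ := banach_steinhaus (g := fun s : Set.Icc (0 : ℝ) τ => G.E s) fun x => by
    obtain ⟨c, hc⟩ := isCompact_Icc.exists_bound_of_continuousOn
      ((G.E_cont x).mono (Set.Icc_subset_Ici_self : Set.Icc 0 τ ⊆ _))
    exact ⟨c, fun s => hc s s.2⟩
  exact ⟨max M 0, le_max_right _ _, fun s hs => (hM ⟨s, hs⟩).trans (le_max_left _ _)⟩

theorem exists_E_near (u : X) {η : ℝ} (hη : 0 < η) :
    ∃ a > 0, ∃ v ∈ G.dom, ‖u - G.E a v‖ < η := by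
  obtain ⟨v, hv, hvd⟩ := G.dense_dom.exists_dist_lt u (half_pos hη)
  have h : Tendsto (fun t => G.E t v) (𝓝[>] 0) (𝓝 v) := by
    have := (G.E_cont v 0 Set.self_mem_Ici).mono Set.Ioi_subset_Ici_self
    simpa [ContinuousWithinAt, G.E_zero] using this
  obtain ⟨a, had, ha⟩ :=
    ((Metric.tendsto_nhds.1 h _ (half_pos hη)).and self_mem_nhdsWithin).exists
  refine ⟨a, ha, v, hv, ?_⟩
  rw [← dist_eq_norm]
  rw [dist_comm] at had
  linarith [dist_triangle u v (G.E a v)]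

end Generator

namespace IsProperFamily

variable {X : Type*} [NormedAddCommGroup X] [NormedSpace ℝ X] {S : ℝ → X →L[ℝ] X}
  {G : Generator X}

/-- Products of the `S t` along lists of small total length are close to the identity,
uniformly on compact sets. -/
theorem exists_norm_prod_map_sub_le (hS : IsProperFamily S G) {A : Set X} (hA : IsCompact A)
    {η : ℝ} (hη : 0 < η) :
    ∃ δ : ℝ, 0 < δ ∧ ∀ l : List ℝ, (∀ t ∈ l, 0 < t) → l.sum ≤ δ →
      ∀ x ∈ A, ‖(l.map S).prod x - x‖ ≤ η := by
  obtain ⟨-, -, ⟨C, ε, hC, hε, hSb⟩, hSd⟩ := hS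
  refine hA.induction_on ⟨1, one_pos, by simp⟩ ?_ ?_ fun x hx => ?_
  · rintro s t hst ⟨δ, hδ, h⟩
    exact ⟨δ, hδ, fun l hl hs x hx => h l hl hs x (hst hx)⟩
  · rintro s t ⟨δ₁, hδ₁, h₁⟩ ⟨δ₂, hδ₂, h₂⟩
    refine ⟨min δ₁ δ₂, lt_min hδ₁ hδ₂, fun l hl hs x hx => ?_⟩
    rcases hx with hx | hx
    · exact h₁ l hl (hs.trans (min_le_left _ _)) x hx
    · exact h₂ l hl (hs.trans (min_le_right _ _)) x hx
  · set K := Real.exp C with hK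
    have hK0 : 0 < K := Real.exp_pos _
    obtain ⟨a, ha, v, hv, hd⟩ := G.exists_E_near x
      (show 0 < η / (4 * (K + 1)) by positivity)
    set d := G.E a v
    obtain ⟨δ, hδ, hSδ⟩ := exists_norm_sub_sub_smul_le (hSd a ha v hv) one_pos
    set c := 1 + ‖G.L d‖
    have hc : 0 < c := by positivity
    refine ⟨Metric.ball x (η / (4 * (K + 1))),
      mem_nhdsWithin_of_mem_nhds (Metric.ball_mem_nhds _ (by positivity)),
      min (min 1 ε) (min δ (η / (2 * K * c))), by positivity, fun l hl hs z hz => ?_⟩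
    obtain ⟨⟨hs1, hsε⟩, hsδ, hsη⟩ : (l.sum ≤ 1 ∧ l.sum ≤ ε) ∧ l.sum ≤ δ ∧
        l.sum ≤ η / (2 * K * c) := by simpa using hs
    have hsum := sum_nonneg_of_forall_pos hl
    have hlε : ∀ t ∈ l, 0 < t ∧ t ≤ ε := fun t ht =>
      ⟨hl t ht, (le_sum_of_forall_pos hl ht).trans hsε⟩
    have hexp : Real.exp (C * l.sum) ≤ K := Real.exp_le_exp.2 (by nlinarith)
    have h1 : ‖(l.map S).prod‖ ≤ K := (norm_prod_map_le hSb hlε).trans hexp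
    have h2 : ‖(l.map S).prod d - d‖ ≤ η / 2 := by
      refine (norm_prod_map_sub_le hC.le hSb hc.le hlε fun t ht => ?_).trans ?_
      · have h := hSδ t (hl t ht) ((le_sum_of_forall_pos hl ht).trans hsδ)
        have h' := norm_le_norm_sub_add (S t d - d) (t • G.L d)
        rw [norm_smul, Real.norm_of_nonneg (hl t ht).le] at h'
        calc _ ≤ _ := h'
          _ ≤ 1 * t + t * ‖G.L d‖ := by gcongr
          _ = c * t := by ring
      · calc _ ≤ K * (c * (η / (2 * K * c))) := by gcongr
          _ = η / 2 := by field_simp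
    have h3 : ‖z - d‖ ≤ η / (2 * (K + 1)) := by
      have h4 := norm_sub_le_norm_sub_add_norm_sub z x d
      rw [Metric.mem_ball, dist_eq_norm] at hz
      have : η / (2 * (K + 1)) = η / (4 * (K + 1)) + η / (4 * (K + 1)) := by
        field_simp; norm_num
      linarith
    have h4 : (l.map S).prod z - z
        = (l.map S).prod (z - d) + ((l.map S).prod d - d) - (z - d) := by
      rw [map_sub]; abel
    rw [h4]
    calc _ ≤ ‖(l.map S).prod (z - d)‖ + ‖(l.map S).prod d - d‖ + ‖z - d‖ :=
          (norm_sub_le _ _).trans (by gcongr; exact norm_add_le _ _)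
      _ ≤ K * (η / (2 * (K + 1))) + η / 2 + η / (2 * (K + 1)) := by
          gcongr
          exact ((l.map S).prod.le_opNorm _).trans (by gcongr)
      _ = η := by field_simp; ring

set_option maxHeartbeats 400000 in
/-- On vectors `E a v`, the product over any sufficiently fine partition of an interval of
length close to `τ` is close to `E τ`. -/
theorem exists_norm_prod_map_sub_E_le [CompleteSpace X] (hS : IsProperFamily S G) {τ : ℝ}
    (hτ : 0 < τ) {a : ℝ} (ha : 0 < a) {v : X} (hv : v ∈ G.dom) {ρ : ℝ} (hρ : 0 < ρ) :
    ∃ δ : ℝ, 0 < δ ∧ ∀ l : List ℝ, (∀ t ∈ l, 0 < t ∧ t ≤ δ) → |l.sum - τ| ≤ δ →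
      ‖(l.map S).prod (G.E a v) - G.E τ (G.E a v)‖ ≤ ρ := by
  obtain ⟨C, ε, hC, hε, hSb⟩ := hS.2.2.1
  obtain ⟨M, hM, hEM⟩ := G.exists_norm_E_le τ
  set w := G.E a v with hw
  set y := G.L w with hy
  have hwd : w ∈ G.dom := G.E_maps_dom a ha.le v hv
  set K := Real.exp C with hK
  have hK0 : 0 < K := Real.exp_pos _
  set B := 3 * (K + 1) + 1 + M with hB
  have hB0 : 0 < B := by positivity
  set η := ρ / (2 * τ * B * Real.exp (3 * C * τ)) with hη
  have hη0 : 0 < η := by positivity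
  obtain ⟨δ₀, hδ₀, hcomp⟩ := hS.exists_norm_prod_map_sub_le
    ((isCompact_Icc (a := (0 : ℝ)) (b := τ)).image_of_continuousOn
      ((G.E_cont y).mono Set.Icc_subset_Ici_self)) hη0
  obtain ⟨h₀, hh₀, hE⟩ := exists_norm_sub_sub_smul_le (G.E_deriv w hwd) hη0
  obtain ⟨σ, hσ, hσ1, hσε, hσδ, hσh⟩ :
      ∃ σ : ℝ, 0 < σ ∧ σ ≤ 1 ∧ σ ≤ ε ∧ σ ≤ δ₀ ∧ σ ≤ h₀ :=
    ⟨min (min 1 ε) (min δ₀ h₀), by positivity, by simp, by simp, by simp, by simp⟩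
  obtain ⟨N, hN⟩ := exists_nat_gt (3 * τ / σ)
  have hN0 : (0 : ℝ) < N := lt_trans (by positivity) hN
  set h := τ / N with hh
  have hh0 : 0 < h := by positivity
  have hNh : N * h = τ := by rw [hh]; field_simp
  have h3σ : 3 * h ≤ σ := by
    rw [div_lt_iff₀ hσ] at hN
    rw [hh, mul_div_assoc', div_le_iff₀ hN0]
    linarith
  have key : ∀ k : ℕ, k ≤ N → ∃ δ : ℝ, 0 < δ ∧ ∀ l : List ℝ, (∀ t ∈ l, 0 < t ∧ t ≤ δ) →
      |l.sum - k * h| ≤ δ →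
      ‖(l.map S).prod w - G.E (k * h) w‖ ≤ (k + 1) * h * η * B * Real.exp (3 * C * (k * h)) := by
    intro k
    induction k with
    | zero =>
      intro _
      obtain ⟨δ, hδ, hδw⟩ := hS.exists_norm_prod_map_sub_le (isCompact_singleton (x := w))
        (show 0 < h * η * B by positivity)
      refine ⟨δ, hδ, fun l hl hls => ?_⟩
      simp only [Nat.cast_zero, zero_mul, sub_zero] at hls
      simpa [G.E_zero] using hδw l (fun t ht => (hl t ht).1) ((le_abs_self _).trans hls) w rfl
    | succ k ih =>
      intro hk
      obtain ⟨δ₁, hδ₁, ih⟩ := ih (by omega)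
      have hkh0 : 0 ≤ k * h := by positivity
      have hkτ : k * h ≤ τ := by
        rw [← hNh]
        have : (k : ℝ) ≤ N := by exact_mod_cast (by omega : k ≤ N)
        gcongr
      have hLk : G.L (G.E (k * h) w) = G.E (k * h) y := G.L_E hkh0 hwd
      obtain ⟨δ₂, hδ₂, hSk⟩ := exists_norm_sub_sub_smul_le
        (hS.2.2.2 (k * h + a) (by positivity) v hv) hη0
      rw [G.E_add_apply hkh0 ha.le, ← hw, hLk] at hSk
      set x := G.E (k * h) w with hx
      set z := G.E (k * h) y with hz
      obtain ⟨δ, hδ, hδδ₁, hδδ₂, hδh, hδz⟩ : ∃ δ : ℝ, 0 < δ ∧ 2 * δ ≤ δ₁ ∧ δ ≤ δ₂ ∧ δ ≤ h ∧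
          2 * δ * ‖z‖ ≤ η * h := by
        refine ⟨min (min (δ₁ / 2) δ₂) (min h (η * h / (2 * (‖z‖ + 1)))), by positivity,
          ?_, by simp, by simp, ?_⟩
        · have : min (min (δ₁ / 2) δ₂) (min h (η * h / (2 * (‖z‖ + 1)))) ≤ δ₁ / 2 := by simp
          linarith
        · have : min (min (δ₁ / 2) δ₂) (min h (η * h / (2 * (‖z‖ + 1))))
              ≤ η * h / (2 * (‖z‖ + 1)) := by simp
          rw [le_div_iff₀ (by positivity)] at this
          have h' : 0 < min (min (δ₁ / 2) δ₂) (min h (η * h / (2 * (‖z‖ + 1)))) := by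
            positivity
          linarith
      refine ⟨δ, hδ, fun l hl hls => ?_⟩
      push_cast at hls ⊢
      have hls' := abs_le.1 hls
      obtain ⟨l₁, l₂, rfl, hl₂⟩ := exists_append_abs_sum_sub_le hl hkh0 (by linarith)
      have hl₂' := abs_le.1 hl₂
      rw [List.sum_append] at hls'
      have hp₁ : ∀ t ∈ l₁, 0 < t ∧ t ≤ δ := fun t ht => hl t (List.mem_append_left _ ht)
      have hp₂ : ∀ t ∈ l₂, 0 < t ∧ t ≤ δ := fun t ht => hl t (List.mem_append_right _ ht)
      have hs₁ : |l₁.sum - h| ≤ 2 * δ := by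
        rw [abs_le]; constructor <;> linarith
      have hs₁h : l₁.sum ≤ 3 * h := by linarith [abs_le.1 hs₁]
      have hs₁σ : l₁.sum ≤ σ := hs₁h.trans h3σ
      have hprev := ih l₂ (fun t ht => ⟨(hp₂ t ht).1, by linarith [(hp₂ t ht).2]⟩)
        (by linarith)
      have hbound : ∀ l : List ℝ, (∀ t ∈ l, 0 < t) → l.sum ≤ σ →
          ‖(l.map S).prod‖ ≤ Real.exp (C * l.sum) := fun l hl hs =>
        norm_prod_map_le hSb fun t ht =>
          ⟨hl t ht, (le_sum_of_forall_pos hl ht).trans (hs.trans hσε)⟩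
      have hstep := norm_prod_map_sub_sub_smul_le (K := K) hSk
        (fun l hl hs => (hbound l hl hs).trans (Real.exp_le_exp.2 (by nlinarith)))
        (fun l hl hs => hcomp l hl (hs.trans hσδ) z ⟨k * h, ⟨hkh0, hkτ⟩, rfl⟩)
        (fun t ht => ⟨(hp₁ t ht).1, (hp₁ t ht).2.trans hδδ₂⟩) hs₁σ
      have hEstep : ‖G.E ((k + 1) * h) w - x - h • z‖ ≤ M * (η * h) := by
        have e : G.E ((k + 1) * h) w - x - h • z = G.E (k * h) (G.E h w - w - h • y) := by
          rw [add_mul, one_mul, G.E_add_apply hkh0 hh0.le, map_sub, map_sub, map_smul]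
        rw [e]
        refine ((G.E (k * h)).le_opNorm _).trans ?_
        have := hE h hh0 (by linarith)
        have := hEM (k * h) ⟨hkh0, hkτ⟩
        gcongr
      have hQ : ‖(l₁.map S).prod‖ ≤ Real.exp (3 * C * h) :=
        (hbound l₁ (fun t ht => (hp₁ t ht).1) hs₁σ).trans
          (Real.exp_le_exp.2 (by nlinarith))
      have hexp1 : 1 ≤ Real.exp (3 * C * h) * Real.exp (3 * C * (k * h)) := by
        rw [← Real.exp_add]
        exact Real.one_le_exp (by positivity)
      rw [List.map_append, List.prod_append, mul_apply_eq_comp]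
      have hηh : 0 < h * η * B := by positivity
      calc _ ≤ ‖(l₁.map S).prod‖ * ‖(l₂.map S).prod w - x‖
            + ‖(l₁.map S).prod x - x - l₁.sum • z‖ + |l₁.sum - h| * ‖z‖
            + ‖G.E ((k + 1) * h) w - x - h • z‖ := norm_apply_sub_le _ _ _ _ _ _ _
        _ ≤ Real.exp (3 * C * h) * ((k + 1) * h * η * B * Real.exp (3 * C * (k * h)))
            + (K + 1) * η * (3 * h) + η * h + M * (η * h) := by
            refine add_le_add (add_le_add (add_le_add ?_ ?_) ?_) hEstep
            · exact mul_le_mul hQ hprev (norm_nonneg _) (Real.exp_nonneg _)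
            · exact hstep.trans (mul_le_mul_of_nonneg_left hs₁h (by positivity))
            · exact (mul_le_mul_of_nonneg_right hs₁ (norm_nonneg _)).trans hδz
        _ = Real.exp (3 * C * h) * ((k + 1) * h * η * B * Real.exp (3 * C * (k * h)))
            + 1 * (h * η * B) := by rw [hB]; ring
        _ ≤ Real.exp (3 * C * h) * ((k + 1) * h * η * B * Real.exp (3 * C * (k * h)))
            + Real.exp (3 * C * h) * Real.exp (3 * C * (k * h)) * (h * η * B) := by
            exact add_le_add_right (mul_le_mul_of_nonneg_right hexp1 hηh.le) _
        _ = _ := by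
            rw [show 3 * C * ((k + 1) * h) = 3 * C * h + 3 * C * (k * h) by ring, Real.exp_add]
            ring
  obtain ⟨δ, hδ, hfin⟩ := key N le_rfl
  rw [hNh] at hfin
  refine ⟨δ, hδ, fun l hl hls => (hfin l hl hls).trans ?_⟩
  have hN1 : (1 : ℝ) ≤ N := by
    have : 0 < N := by exact_mod_cast hN0
    exact_mod_cast this
  have hhτ : h ≤ τ := div_le_self hτ.le hN1
  have hNτ : (N + 1) * h ≤ 2 * τ := by linarith
  calc _ ≤ 2 * τ * η * B * Real.exp (3 * C * τ) := by gcongr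
    _ = ρ := by rw [hη]; field_simp

end IsProperFamily

/-- Chernoff's theorem (non-equidistant version): if `S` is a proper family with generator
`L = DS` and `𝒯 n` are partitions with total length tending to `τ > 0` and mesh tending to
`0`, then `S_{t₁ⁿ} ∘ ⋯ ∘ S_{t_{rₙ}ⁿ} u → e^{τL} u` for every `u`. -/
theorem chernoff_theorem
    {X : Type*} [NormedAddCommGroup X] [NormedSpace ℝ X] [CompleteSpace X]
    (G : Generator X) (S : ℝ → X →L[ℝ] X) (hS : IsProperFamily S G)
    (τ : ℝ) (hτ : 0 < τ) (𝒯 : ℕ → List ℝ)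
    (hpos : ∀ n, ∀ t ∈ 𝒯 n, (0:ℝ) < t)
    (hlen : Tendsto (fun n => (𝒯 n).sum) atTop (𝓝 τ))
    (hmesh : Tendsto (fun n => (𝒯 n).foldr max 0) atTop (𝓝 0))
    (u : X) :
    Tendsto (fun n => ((𝒯 n).map S).prod u) atTop (𝓝 (G.E τ u)) := by
  obtain ⟨-, -, ⟨C, ε, hC, hε, hSb⟩, -⟩ := id hS
  rw [Metric.tendsto_nhds]
  intro ρ hρ
  set K := Real.exp (C * (τ + 1)) with hK
  have hK0 : 0 < K := Real.exp_pos _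
  set c := K + ‖G.E τ‖ with hc
  have hc0 : 0 < c := by positivity
  obtain ⟨a, ha, v, hv, hw⟩ := G.exists_E_near u (show 0 < ρ / (2 * c) by positivity)
  set w := G.E a v with hwdef
  obtain ⟨δ, hδ, hfine⟩ := hS.exists_norm_prod_map_sub_E_le hτ ha hv
    (show 0 < ρ / 4 by positivity)
  have hδ' : 0 < min δ (min ε 1) := by positivity
  filter_upwards [Metric.tendsto_nhds.1 hlen _ hδ', hmesh.eventually_le_const hδ'] with n h1 h2
  have h1 := h1.le
  rw [Real.dist_eq, le_min_iff, le_min_iff] at h1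
  rw [le_min_iff, le_min_iff] at h2
  have hP : ‖((𝒯 n).map S).prod‖ ≤ K := by
    refine (norm_prod_map_le hSb fun t ht =>
      ⟨hpos n t ht, (le_foldr_max ht).trans h2.2.1⟩).trans ?_
    have := (abs_le.1 h1.2.2).2
    exact Real.exp_le_exp.2 (by gcongr; linarith)
  have hfine := hfine (𝒯 n) (fun t ht => ⟨hpos n t ht, (le_foldr_max ht).trans h2.1⟩) h1.1
  rw [← hwdef] at hfine
  have e : ((𝒯 n).map S).prod u - G.E τ u
      = ((𝒯 n).map S).prod (u - w) + (((𝒯 n).map S).prod w - G.E τ w) - G.E τ (u - w) := by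
    simp only [map_sub]
    abel
  rw [dist_eq_norm, e]
  calc _ ≤ ‖((𝒯 n).map S).prod (u - w)‖ + ‖((𝒯 n).map S).prod w - G.E τ w‖
        + ‖G.E τ (u - w)‖ := (norm_sub_le _ _).trans (by gcongr; exact norm_add_le _ _)
    _ ≤ K * (ρ / (2 * c)) + ρ / 4 + ‖G.E τ‖ * (ρ / (2 * c)) := by
        gcongr
        · exact (((𝒯 n).map S).prod.le_opNorm _).trans (by gcongr)
        · exact ((G.E τ).le_opNorm _).trans (by gcongr)
    _ = c * (ρ / (2 * c)) + ρ / 4 := by rw [hc]; ring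
    _ = ρ / 2 + ρ / 4 := by field_simp
    _ < ρ := by linarith
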